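/- For every 0 < a < 1 there exists an infinite proper subset I ⊂ ℕ such that Λ_I ⊂ (0,a) and the box dimension of Λ_I does not exist, i.e. dim_LB Λ_I < dim_UB Λ_I. -/

import Mathlib

open Set Metric Filter Topology MeasureTheory

noncomputable section

/-- Least number of open balls of radius `r` needed to cover `E`. -/
def coveringNumber {α : Type*} [PseudoMetricSpace α] (E : Set α) (r : ℝ) : ℕ :=
  sInf {n : ℕ | ∃ t : Finset α, t.card = n ∧ E ⊆ ⋃ x ∈ t, Metric.ball x r}

/-- `s_E(r) = log N_r(E) / log (1/r)`. -/
def sFun {α : Type*} [PseudoMetricSpace α] (E : Set α) (r : ℝ) : ℝ :=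
  Real.log (coveringNumber E r) / Real.log (1 / r)

/-- Lower box dimension. -/
def dimLB {α : Type*} [PseudoMetricSpace α] (E : Set α) : ℝ :=
  Filter.liminf (fun r => sFun E r) (nhdsWithin (0 : ℝ) (Set.Ioi 0))

/-- Upper box dimension. -/
def dimUB {α : Type*} [PseudoMetricSpace α] (E : Set α) : ℝ :=
  Filter.limsup (fun r => sFun E r) (nhdsWithin (0 : ℝ) (Set.Ioi 0))

/-- Upper right Dini derivative. -/
def upperDini (g : ℝ → ℝ) (x : ℝ) : ℝ :=
  Filter.limsup (fun h => (g (x + h) - g x) / h) (nhdsWithin (0 : ℝ) (Set.Ioi 0))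

/-- The class `𝒢(λ, α)`. -/
def GClass (lam alp : ℝ) : Set (ℝ → ℝ) :=
  {g | Continuous g ∧ (∀ x, g x ∈ Set.Icc lam alp) ∧
    ∀ x, upperDini g x ∈ Set.Icc (lam - g x) (alp - g x)}

/-- Asymptotic equivalence of two functions. -/
def AsympEquiv (f g : ℝ → ℝ) : Prop :=
  Filter.Tendsto (fun x => f x - g x) Filter.atTop (nhds 0)

/-- `E` has covering class `g`. -/
def HasCoveringClass {α : Type*} [PseudoMetricSpace α] (E : Set α) (g : ℝ → ℝ) : Prop :=
  AsympEquiv (fun x => sFun E (Real.exp (-Real.exp x))) g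

/-- Composition of the maps indexed by a finite word. -/
def compMaps {α : Type*} {I : Type*} (T : I → α → α) : List I → α → α
  | [] => id
  | i :: w => T i ∘ compMaps T w

/-- A conformal iterated function system on `ℝ^d` satisfying the open set condition
and the cone condition. -/
structure CIFS (d : ℕ) where
  /-- the compact seed set -/
  X : Set (EuclideanSpace ℝ (Fin d))
  /-- the countable index set -/
  I : Type
  /-- the contractions -/
  S : I → EuclideanSpace ℝ (Fin d) → EuclideanSpace ℝ (Fin d)
  hXcompact : IsCompact X
  hXconn : IsConnected X
  hXint : (interior X).Nonempty
  hIcount : Countable I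
  hInonempty : Nonempty I
  hSmaps : ∀ i, Set.MapsTo (S i) X X
  /-- the uniform contraction ratio -/
  c : ℝ
  hc0 : 0 < c
  hc1 : c < 1
  hcontr : ∀ i, ∀ x ∈ X, ∀ y ∈ X,
    (x ≠ y → 0 < dist (S i x) (S i y)) ∧ dist (S i x) (S i y) ≤ c * dist x y
  /-- the open connected set on which the maps extend conformally -/
  V : Set (EuclideanSpace ℝ (Fin d))
  hVopen : IsOpen V
  hVbdd : Bornology.IsBounded V
  hVconn : IsConnected V
  hXV : X ⊆ V
  /-- the conformal extensions -/
  T : I → EuclideanSpace ℝ (Fin d) → EuclideanSpace ℝ (Fin d)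
  hTagree : ∀ i, ∀ x ∈ X, T i x = S i x
  hTmaps : ∀ i, Set.MapsTo (T i) V V
  hTinj : ∀ i, Set.InjOn (T i) V
  /-- the Hölder exponent in `C^{1+ε}` -/
  eps : ℝ
  heps : 0 < eps
  hTdiff : ∀ i, ContDiffOn ℝ 1 (T i) V
  hTholder : ∀ i, ∃ C : ℝ, 0 < C ∧ ∀ x ∈ V, ∀ y ∈ V,
    ‖fderiv ℝ (T i) x - fderiv ℝ (T i) y‖ ≤ C * ‖x - y‖ ^ eps
  hTconf : ∀ i, ∀ x ∈ V, IsConformalMap (fderiv ℝ (T i) x)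
  /-- the bounded distortion constant -/
  K : ℝ
  hK : 1 ≤ K
  hBD : ∀ w : List I, ∀ x ∈ V, ∀ y ∈ V,
    ‖fderiv ℝ (compMaps T w) x‖ ≤ K * ‖fderiv ℝ (compMaps T w) y‖
  hOSCin : ∀ i, S i '' interior X ⊆ interior X
  hOSCdisj : ∀ i j, i ≠ j → Disjoint (S i '' interior X) (S j '' interior X)
  hCone : ∃ κ : ℝ, 0 < κ ∧ ∀ x ∈ X, ∀ r : ℝ, 0 < r → r < 1 →
    ENNReal.ofReal (κ * r ^ d) ≤ volume (Metric.ball x r ∩ interior X)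

/-- The limit set (attractor) of a CIFS. -/
def CIFS.limitSet {d : ℕ} (Φ : CIFS d) : Set (EuclideanSpace ℝ (Fin d)) :=
  ⋃ γ : ℕ → Φ.I, ⋂ n : ℕ, compMaps Φ.S (List.ofFn fun k : Fin (n + 1) => γ k) '' Φ.X

/-- The set of fixed points of the maps of a CIFS. -/
def CIFS.fixedPoints {d : ℕ} (Φ : CIFS d) : Set (EuclideanSpace ℝ (Fin d)) :=
  {x | x ∈ Φ.X ∧ ∃ i, Φ.S i x = x}

/-- `ρ(w) = sup_{x ∈ X} ‖S'_w(x)‖`. -/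
def CIFS.rho {d : ℕ} (Φ : CIFS d) (w : List Φ.I) : ℝ :=
  sSup ((fun x => ‖fderiv ℝ (compMaps Φ.T w) x‖) '' Φ.X)

/-- `Ψ(r, θ) = (1 - θ)·dim_H Λ + θ·s_F(r^θ)`. -/
def CIFS.Psi {d : ℕ} (Φ : CIFS d) (r θ : ℝ) : ℝ :=
  (1 - θ) * (dimH Φ.limitSet).toReal + θ * sFun Φ.fixedPoints (r ^ θ)

/-- `ψ(r) = max_{θ ∈ [0,1]} Ψ(r,θ)` (which equals the supremum over `θ ∈ (0,1]`,
since `Ψ(r,0)` is defined as the limit of `Ψ(r,θ)` as `θ → 0⁺`). -/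
def CIFS.psi {d : ℕ} (Φ : CIFS d) (r : ℝ) : ℝ :=
  sSup (Φ.Psi r '' Set.Ioc (0 : ℝ) 1)

/-- The interval `𝒟(h, s, t, α)`. -/
def Dset (h s t α : ℝ) : Set ℝ :=
  if t ≤ h then {h}
  else Set.Icc (max h s) (h + (t - h) * (α - h) * s / (α * t - h * s))

/-- The quantity whose limit as `θ → 1⁻` is the quasi-Assouad dimension. -/
def quasiAssouadAux {α : Type*} [PseudoMetricSpace α] (E : Set α) (θ : ℝ) : ℝ :=
  sInf {t : ℝ | 0 ≤ t ∧ ∃ C : ℝ, 0 < C ∧ ∀ x ∈ E, ∀ r R : ℝ,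
    0 < r → r ≤ R ^ (1 / θ) → R ^ (1 / θ) ≤ R → R < 1 →
    (coveringNumber (E ∩ Metric.ball x R) r : ℝ) ≤ C * (R / r) ^ t}

/-- The quasi-Assouad dimension. -/
def dimqA {α : Type*} [PseudoMetricSpace α] (E : Set α) : ℝ :=
  Filter.limsup (quasiAssouadAux E) (nhdsWithin (1 : ℝ) (Set.Iio 1))

/-- The modified lower box dimension. -/
def dimLMB {α : Type*} [PseudoMetricSpace α] (K : Set α) : ℝ :=
  sInf {s : ℝ | ∃ C : ℕ → Set α, (K ⊆ ⋃ i, C i) ∧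
    (∀ i, (C i).Nonempty ∧ Bornology.IsBounded (C i)) ∧ s = ⨆ i, dimLB (C i)}

/-- The unit cube `[0,1]^d`. -/
def unitCube (d : ℕ) : Set (EuclideanSpace ℝ (Fin d)) :=
  {x | ∀ j, x j ∈ Set.Icc (0 : ℝ) 1}

/-- The basic similarity maps in the homogeneous Moran construction. -/
def moranMap (d : ℕ) (r : ℝ) (i : Fin d → Bool)
    (x : EuclideanSpace ℝ (Fin d)) : EuclideanSpace ℝ (Fin d) :=
  (EuclideanSpace.equiv (Fin d) ℝ).symm (fun j => r * x j + (if i j then 1 - r else 0))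

/-- The `n`-th level of the homogeneous Moran construction. -/
def moranLevel (d : ℕ) : (ℕ → ℝ) → ℕ → Set (EuclideanSpace ℝ (Fin d))
  | _, 0 => unitCube d
  | r, n + 1 => ⋃ i : Fin d → Bool, moranMap d (r 1) i '' moranLevel d (fun k => r (k + 1)) n

/-- The homogeneous Moran set `M(r)`. -/
def moranSet (d : ℕ) (r : ℕ → ℝ) : Set (EuclideanSpace ℝ (Fin d)) :=
  ⋂ n, moranLevel d r (n + 1)

/-- The Gauss map `x ↦ 1/x - ⌊1/x⌋`. -/
def gaussMap (x : ℝ) : ℝ := Int.fract (1 / x)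

/-- The `n`-th partial quotient (continued fraction digit) of `x` (`n = 0` gives `b₁ = ⌊1/x⌋`). -/
def cfDigit (x : ℝ) (n : ℕ) : ℤ := ⌊1 / gaussMap^[n] x⌋

/-- The set of irrationals in `(0,1)` all of whose continued fraction digits lie in `I`. -/
def cfSet (I : Set ℕ) : Set ℝ :=
  {x | x ∈ Set.Ioo (0 : ℝ) 1 ∧ Irrational x ∧ ∀ n : ℕ, ∃ b ∈ I, cfDigit x n = (b : ℤ)}

theorem coveringNumber_le_card {α : Type*} [PseudoMetricSpace α] {E : Set α} {r : ℝ}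
    (t : Finset α) (h : E ⊆ ⋃ x ∈ t, Metric.ball x r) : coveringNumber E r ≤ t.card :=
  Nat.sInf_le ⟨t, rfl, h⟩

theorem exists_finset_cover_unitInterval {E : Set ℝ} (hE : E ⊆ Ioo 0 1) {r : ℝ} (hr : 0 < r) :
    ∃ t : Finset ℝ, (t.card : ℝ) ≤ 1 / r + 1 ∧ E ⊆ ⋃ x ∈ t, Metric.ball x r := by
  classical
  refine ⟨(Finset.range (⌊1 / r⌋₊ + 1)).image fun k : ℕ => (k : ℝ) * r, ?_, ?_⟩
  · have h1 : (((Finset.range (⌊1 / r⌋₊ + 1)).image fun k : ℕ => (k : ℝ) * r).card : ℝ)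
        ≤ ((⌊1 / r⌋₊ + 1 : ℕ) : ℝ) := by
      exact_mod_cast Finset.card_image_le.trans (Finset.card_range _).le
    have h2 : (⌊1 / r⌋₊ : ℝ) ≤ 1 / r := Nat.floor_le (by positivity)
    push_cast at h1
    linarith
  · intro x hx
    obtain ⟨hx0, hx1⟩ := hE hx
    simp only [mem_iUnion, Finset.mem_image, Finset.mem_range, Metric.mem_ball, exists_prop]
    refine ⟨(⌊x / r⌋₊ : ℝ) * r, ⟨⌊x / r⌋₊, ?_, rfl⟩, ?_⟩
    · exact Nat.lt_succ_of_le (Nat.floor_le_floor (by gcongr))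
    · have h1 : (⌊x / r⌋₊ : ℝ) ≤ x / r := Nat.floor_le (by positivity)
      have h2 : x / r < ⌊x / r⌋₊ + 1 := Nat.lt_floor_add_one _
      rw [le_div_iff₀ hr] at h1
      rw [div_lt_iff₀ hr] at h2
      rw [Real.dist_eq, abs_lt]
      constructor <;> linarith

theorem exists_finset_card_eq_coveringNumber {E : Set ℝ} (hE : E ⊆ Ioo 0 1) {r : ℝ}
    (hr : 0 < r) :
    ∃ t : Finset ℝ, t.card = coveringNumber E r ∧ E ⊆ ⋃ x ∈ t, Metric.ball x r := by
  obtain ⟨t, -, ht⟩ := exists_finset_cover_unitInterval hE hr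
  exact Nat.sInf_mem (s := {n : ℕ | ∃ t : Finset ℝ, t.card = n ∧ E ⊆ ⋃ x ∈ t, Metric.ball x r})
    ⟨_, t, rfl, ht⟩

theorem coveringNumber_le_inv_add_one {E : Set ℝ} (hE : E ⊆ Ioo 0 1) {r : ℝ} (hr : 0 < r) :
    (coveringNumber E r : ℝ) ≤ 1 / r + 1 := by
  obtain ⟨t, hc, ht⟩ := exists_finset_cover_unitInterval hE hr
  exact le_trans (by exact_mod_cast coveringNumber_le_card t ht) hc

theorem coveringNumber_le_one {E : Set ℝ} (hE : E ⊆ Ioo 0 1) {r : ℝ} (hr : 1 ≤ r) :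
    coveringNumber E r ≤ 1 := by
  refine coveringNumber_le_card {0} fun x hx => ?_
  obtain ⟨hx0, hx1⟩ := hE hx
  simp only [Finset.mem_singleton, iUnion_iUnion_eq_left, Metric.mem_ball, Real.dist_eq, sub_zero,
    abs_of_pos hx0]
  linarith

/-- A finite family of points with pairwise distances at least `2 r` forces many balls. -/
theorem le_coveringNumber {E : Set ℝ} (hE : E ⊆ Ioo 0 1) {r : ℝ} (hr : 0 < r) {n : ℕ}
    (f : ℕ → ℝ) (hf : ∀ j < n, f j ∈ E)
    (hsep : ∀ i j, i < j → j < n → 2 * r ≤ f i - f j) : n ≤ coveringNumber E r := by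
  obtain ⟨t, hc, ht⟩ := exists_finset_card_eq_coveringNumber hE hr
  have h : ∀ j, ∃ c, j < n → c ∈ t ∧ f j ∈ Metric.ball c r := by
    intro j
    by_cases hj : j < n
    · obtain ⟨c, hc, hjc⟩ := mem_iUnion₂.1 (ht (hf j hj))
      exact ⟨c, fun _ => ⟨hc, hjc⟩⟩
    · exact ⟨0, fun h => absurd h hj⟩
  choose c hc' using h
  rw [← hc, ← Finset.card_range n]
  have key : ∀ i j, i < j → j < n → c i ≠ c j := by
    intro i j hij hj he
    have h1 := (hc' i (hij.trans hj)).2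
    have h2 := (hc' j hj).2
    rw [← he] at h2
    rw [Metric.mem_ball, Real.dist_eq, abs_lt] at h1 h2
    linarith [hsep i j hij hj]
  refine Finset.card_le_card_of_injOn c (fun j hj => (hc' j (by simpa using hj)).1) ?_
  intro i hi j hj he
  simp only [Finset.coe_range, mem_Iio] at hi hj
  rcases lt_trichotomy i j with h | h | h
  · exact absurd he (key i j h hj)
  · exact h
  · exact absurd he.symm (key j i h hi)

theorem sFun_nonneg {α : Type*} [PseudoMetricSpace α] (E : Set α) {r : ℝ} (hr : 0 < r)
    (hr1 : r ≤ 1) : 0 ≤ sFun E r :=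
  div_nonneg (Real.log_natCast_nonneg _)
    (Real.log_nonneg (by rw [le_div_iff₀ hr]; linarith))

theorem sFun_le_two {E : Set ℝ} (hE : E ⊆ Ioo 0 1) {r : ℝ} (hr : 0 < r) (hr1 : r ≤ 1 / 2) :
    sFun E r ≤ 2 := by
  have hr2 : 2 ≤ 1 / r := by rw [le_div_iff₀ hr]; linarith
  have hlog : 0 < Real.log (1 / r) := Real.log_pos (by linarith)
  unfold sFun
  rw [div_le_iff₀ hlog]
  rcases Nat.eq_zero_or_pos (coveringNumber E r) with h | h
  · rw [h]; simp only [Nat.cast_zero, Real.log_zero]; positivity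
  · have h1 := coveringNumber_le_inv_add_one hE hr
    have h2 : (coveringNumber E r : ℝ) ≤ (1 / r) ^ 2 := by nlinarith
    calc Real.log (coveringNumber E r) ≤ Real.log ((1 / r) ^ 2) :=
          Real.log_le_log (by exact_mod_cast h) h2
      _ = 2 * Real.log (1 / r) := by rw [Real.log_pow]; norm_num

theorem dimLB_le_of_seq {E : Set ℝ} {s : ℝ} (u : ℕ → ℝ)
    (hu : Tendsto u atTop (𝓝[>] 0)) (h : ∀ n, sFun E (u n) ≤ s) : dimLB E ≤ s := by
  refine liminf_le_of_frequently_le (hu.frequently (Frequently.of_forall h)) ?_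
  refine isBoundedUnder_of_eventually_ge (a := 0) ?_
  filter_upwards [Ioc_mem_nhdsGT (zero_lt_one (α := ℝ))] with r hr
  exact sFun_nonneg E hr.1 hr.2

theorem le_dimUB_of_seq {E : Set ℝ} (hE : E ⊆ Ioo 0 1) {s : ℝ} (u : ℕ → ℝ)
    (hu : Tendsto u atTop (𝓝[>] 0)) (h : ∀ n, s ≤ sFun E (u n)) : s ≤ dimUB E := by
  refine le_limsup_of_frequently_le (hu.frequently (Frequently.of_forall h)) ?_
  refine isBoundedUnder_of_eventually_le (a := 2) ?_
  filter_upwards [Ioc_mem_nhdsGT (one_half_pos (α := ℝ))] with r hr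
  exact sFun_le_two hE hr.1 hr.2

theorem cfSet_subset_Ioo (I : Set ℕ) : cfSet I ⊆ Ioo 0 1 := fun _ hx => hx.1

theorem cfDigit_succ (x : ℝ) (n : ℕ) : cfDigit x (n + 1) = cfDigit (gaussMap x) n := by
  simp only [cfDigit, Function.iterate_succ, Function.comp_apply]

theorem exists_of_mem_cfSet {I : Set ℕ} {x : ℝ} (hx : x ∈ cfSet I) :
    ∃ b ∈ I, ∃ y ∈ cfSet I, x = 1 / (b + y) := by
  obtain ⟨⟨hx0, hx1⟩, hirr, hd⟩ := hx
  obtain ⟨b, hb, hbx⟩ := hd 0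
  have hbx' : ⌊1 / x⌋ = (b : ℤ) := by simpa [cfDigit] using hbx
  have hg : gaussMap x = 1 / x - b := by
    rw [gaussMap, Int.fract, hbx', Int.cast_natCast]
  have hirr' : Irrational (gaussMap x) := by
    rw [hg, one_div]
    exact (irrational_inv_iff.2 hirr).sub_natCast b
  refine ⟨b, hb, gaussMap x, ⟨⟨?_, Int.fract_lt_one _⟩, hirr', fun n => ?_⟩, ?_⟩
  · exact lt_of_le_of_ne (Int.fract_nonneg _) hirr'.ne_zero.symm
  · simpa only [cfDigit_succ] using hd (n + 1)
  · rw [hg]; field_simp; ring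

theorem one_div_add_mem_cfSet {I : Set ℕ} {b : ℕ} (hb : b ∈ I) (hb1 : 1 ≤ b) {y : ℝ}
    (hy : y ∈ cfSet I) : 1 / (b + y) ∈ cfSet I := by
  obtain ⟨⟨hy0, hy1⟩, hirr, hd⟩ := hy
  have hb1' : (1 : ℝ) ≤ b := by exact_mod_cast hb1
  have hfl : ⌊(b : ℝ) + y⌋ = (b : ℤ) := by
    rw [Int.floor_eq_iff]; push_cast; constructor <;> linarith
  have hg : gaussMap (1 / (b + y)) = y := by
    rw [gaussMap, one_div_one_div, Int.fract, hfl]; push_cast; ring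
  refine ⟨⟨by positivity, ?_⟩, ?_, fun n => ?_⟩
  · rw [div_lt_one (by linarith)]; linarith
  · rw [one_div]; exact irrational_inv_iff.2 (hirr.natCast_add b)
  · cases n with
    | zero => exact ⟨b, hb, by simp only [cfDigit, Function.iterate_zero, id, one_div_one_div, hfl]⟩
    | succ n => simpa only [cfDigit_succ, hg] using hd n

theorem cfSet_nonempty {I : Set ℕ} {b : ℕ} (hb : b ∈ I) (hb1 : 1 ≤ b) : (cfSet I).Nonempty := by
  have hb1' : (1 : ℝ) ≤ b := by exact_mod_cast hb1
  set s := √((b : ℝ) ^ 2 + 4) with hs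
  have hs2 : s ^ 2 = (b : ℝ) ^ 2 + 4 := Real.sq_sqrt (by positivity)
  have hs0 : 0 ≤ s := Real.sqrt_nonneg _
  have hsb : (b : ℝ) < s := by nlinarith
  have hsb2 : s < b + 2 := by nlinarith
  have hirr : Irrational s := by
    have h : ¬ IsSquare (b ^ 2 + 4) := by
      rintro ⟨m, hm⟩
      have h1 : b < m := by nlinarith
      have h2 : m < b + 2 := by nlinarith
      have h3 : m = b + 1 := by omega
      subst h3
      have : 4 = 2 * b + 1 := by nlinarith
      omega
    have := irrational_sqrt_natCast_iff.2 h
    push_cast at this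
    exact this
  set x := (s - b) / 2 with hx
  have hx0 : 0 < x := by rw [hx]; linarith
  have hx1 : x < 1 := by rw [hx]; linarith
  have hinv : 1 / x = b + x := by
    rw [div_eq_iff hx0.ne', hx]; nlinarith
  have hfl : ⌊1 / x⌋ = (b : ℤ) := by
    rw [hinv, Int.floor_eq_iff]; push_cast; constructor <;> linarith
  have hg : gaussMap x = x := by
    rw [gaussMap, Int.fract, hfl, hinv]; push_cast; ring
  refine ⟨x, ⟨hx0, hx1⟩, ?_, fun n => ⟨b, hb, ?_⟩⟩
  · have := (hirr.sub_natCast b).div_natCast (m := 2) (by norm_num)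
    simpa [hx] using this
  · rw [cfDigit, Function.iterate_fixed hg, hfl]

theorem coveringNumber_cfSet_le_sum {I : Set ℕ} {A : Finset ℕ} (hA : ∀ b ∈ A, 2 ≤ b) {L r : ℝ}
    (hL : 0 < L) (hLr : 1 / L ≤ r) (htail : ∀ b ∈ I, b ∉ A → L ≤ b) :
    coveringNumber (cfSet I) r ≤ 1 + ∑ b ∈ A, coveringNumber (cfSet I) ((b : ℝ) ^ 2 * r) := by
  classical
  have hr : 0 < r := lt_of_lt_of_le (by positivity) hLr
  have hex : ∀ b : ℕ, ∃ t : Finset ℝ, b ∈ A →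
      t.card = coveringNumber (cfSet I) ((b : ℝ) ^ 2 * r) ∧
        cfSet I ⊆ ⋃ x ∈ t, Metric.ball x ((b : ℝ) ^ 2 * r) := by
    intro b
    by_cases hb : b ∈ A
    · have : (0 : ℝ) < b := by exact_mod_cast (two_pos.trans_le (hA b hb))
      obtain ⟨t, ht⟩ := exists_finset_card_eq_coveringNumber (cfSet_subset_Ioo I)
        (r := (b : ℝ) ^ 2 * r) (by positivity)
      exact ⟨t, fun _ => ht⟩
    · exact ⟨∅, fun h => absurd h hb⟩
  choose t ht using hex
  let φ : ℕ → ℝ → ℝ := fun b x => 1 / (b + max x 0)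
  refine (coveringNumber_le_card ({r / 2} ∪ A.biUnion fun b => (t b).image (φ b)) ?_).trans ?_
  · intro x hx
    obtain ⟨b, hb, y, hy, hxy⟩ := exists_of_mem_cfSet hx
    obtain ⟨hx0, hx1⟩ := hx.1
    obtain ⟨hy0, hy1⟩ := hy.1
    by_cases hbA : b ∈ A
    · obtain ⟨c, hc, hyc⟩ := mem_iUnion₂.1 ((ht b hbA).2 hy)
      refine mem_iUnion₂.2 ⟨φ b c, ?_, ?_⟩
      · exact Finset.mem_union_right _
          (Finset.mem_biUnion.2 ⟨b, hbA, Finset.mem_image_of_mem _ hc⟩)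
      · have hb2 : (2 : ℝ) ≤ b := by exact_mod_cast hA b hbA
        have hm : 0 ≤ max c 0 := le_max_right _ _
        have h1 : |max c 0 - y| ≤ |y - c| := by
          have := abs_max_sub_max_le_abs c y 0
          rwa [max_eq_left hy0.le, abs_sub_comm c y] at this
        rw [Metric.mem_ball, Real.dist_eq] at hyc ⊢
        have h2 : x - φ b c = (max c 0 - y) / ((b + y) * (b + max c 0)) := by
          have : (b : ℝ) + y ≠ 0 := by positivity
          have : (b : ℝ) + max c 0 ≠ 0 := by positivity
          simp only [hxy, φ]; field_simp; ring
        have h3 : 0 < ((b : ℝ) + y) * (b + max c 0) := by positivity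
        rw [h2, abs_div, abs_of_pos h3, div_lt_iff₀ h3]
        have h4 : (b : ℝ) ^ 2 ≤ (b + y) * (b + max c 0) := by nlinarith
        nlinarith
    · have hLb := htail b hb hbA
      refine mem_iUnion₂.2 ⟨r / 2, Finset.mem_union_left _ (Finset.mem_singleton_self _), ?_⟩
      have hxr : x ≤ r := by
        refine le_trans ?_ hLr
        rw [hxy]
        exact one_div_le_one_div_of_le hL (by linarith)
      rw [Metric.mem_ball, Real.dist_eq, abs_lt]
      constructor <;> linarith
  · refine (Finset.card_union_le _ _).trans ?_
    rw [Finset.card_singleton]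
    refine Nat.add_le_add_left (Finset.card_biUnion_le.trans (Finset.sum_le_sum fun b hb => ?_)) _
    exact Finset.card_image_le.trans (ht b hb).1.le

theorem coveringNumber_cfSet_le_rpow {I : Set ℕ} {A : Finset ℕ} (hA : ∀ b ∈ A, 2 ≤ b) {L t : ℝ}
    (hL : 0 < L) (ht : 0 ≤ t) (htail : ∀ b ∈ I, b ∉ A → L ≤ b)
    (hsum : ∑ b ∈ A, ((b : ℝ) ^ 2) ^ (-t) ≤ 1 / 2) {r : ℝ} (hLr : 1 / L ≤ r) :
    (coveringNumber (cfSet I) r : ℝ) ≤ 2 * (1 + A.card) * r ^ (-t) + 1 := by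
  have main : ∀ n : ℕ, ∀ r : ℝ, 1 / 4 ^ n ≤ r → 1 / L ≤ r →
      (coveringNumber (cfSet I) r : ℝ) ≤ 2 * (1 + A.card) * r ^ (-t) + 1 := by
    intro n
    induction n with
    | zero =>
      intro r hr hLr
      have h1 : coveringNumber (cfSet I) r ≤ 1 :=
        coveringNumber_le_one (cfSet_subset_Ioo I) (by simpa using hr)
      have h2 : (coveringNumber (cfSet I) r : ℝ) ≤ 1 := by exact_mod_cast h1
      have hr0 : 0 ≤ r := le_trans (by positivity) hr
      have : 0 ≤ 2 * (1 + (A.card : ℝ)) * r ^ (-t) := by positivity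
      linarith
    | succ n ih =>
      intro r hr hLr
      have hr0 : 0 < r := lt_of_lt_of_le (by positivity) hr
      rcases le_or_gt 1 r with h1r | h1r
      · have h1 : coveringNumber (cfSet I) r ≤ 1 :=
          coveringNumber_le_one (cfSet_subset_Ioo I) h1r
        have h2 : (coveringNumber (cfSet I) r : ℝ) ≤ 1 := by exact_mod_cast h1
        have : 0 ≤ 2 * (1 + (A.card : ℝ)) * r ^ (-t) := by positivity
        linarith
      have hrt : 1 ≤ r ^ (-t) := Real.one_le_rpow_of_pos_of_le_one_of_nonpos hr0 h1r.le (by linarith)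
      have h1 : (coveringNumber (cfSet I) r : ℝ) ≤
          1 + ∑ b ∈ A, (coveringNumber (cfSet I) ((b : ℝ) ^ 2 * r) : ℝ) := by
        exact_mod_cast coveringNumber_cfSet_le_sum hA hL hLr htail
      have h2 : ∀ b ∈ A, (coveringNumber (cfSet I) ((b : ℝ) ^ 2 * r) : ℝ) ≤
          2 * (1 + A.card) * r ^ (-t) * ((b : ℝ) ^ 2) ^ (-t) + 1 := by
        intro b hb
        have hb2 : (2 : ℝ) ≤ b := by exact_mod_cast hA b hb
        have hb4 : (4 : ℝ) ≤ (b : ℝ) ^ 2 := by nlinarith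
        have h3 : 1 / 4 ^ n ≤ (b : ℝ) ^ 2 * r := by
          have : (1 : ℝ) / 4 ^ n = 4 * (1 / 4 ^ (n + 1)) := by rw [pow_succ]; field_simp
          rw [this]
          gcongr
        refine (ih _ h3 (hLr.trans (by nlinarith))).trans ?_
        rw [Real.mul_rpow (by positivity) hr0.le]
        exact le_of_eq (by ring)
      have h3 := Finset.sum_le_sum h2
      rw [Finset.sum_add_distrib, ← Finset.mul_sum, Finset.sum_const, nsmul_eq_mul, mul_one] at h3
      have hc : (0 : ℝ) ≤ A.card := Nat.cast_nonneg _
      have h4 : 2 * (1 + (A.card : ℝ)) * r ^ (-t) * ∑ b ∈ A, ((b : ℝ) ^ 2) ^ (-t) ≤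
          2 * (1 + A.card) * r ^ (-t) * (1 / 2) := by gcongr
      nlinarith
  obtain ⟨n, hn⟩ := exists_pow_lt_of_lt_one (lt_of_lt_of_le (by positivity : 0 < 1 / L) hLr)
    (by norm_num : (1 / 4 : ℝ) < 1)
  exact main n r (by rw [← one_div_pow]; exact hn.le) hLr

/-- The arithmetic progression of length `m` and step `m` starting at `m ^ 2`. -/
def progressionBlock (m : ℕ) : Finset ℕ := (Finset.range m).image fun j => m ^ 2 + j * m

theorem sq_le_of_mem_progressionBlock {m b : ℕ} (hb : b ∈ progressionBlock m) : m ^ 2 ≤ b := by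
  obtain ⟨j, -, rfl⟩ := Finset.mem_image.1 hb
  exact Nat.le_add_right _ _

theorem card_progressionBlock_le (m : ℕ) : (progressionBlock m).card ≤ m :=
  Finset.card_image_le.trans (Finset.card_range m).le

theorem le_coveringNumber_cfSet {I : Set ℕ} {m : ℕ} (hm : 2 ≤ m)
    (hI : ∀ b ∈ progressionBlock m, b ∈ I) :
    m ≤ coveringNumber (cfSet I) (1 / (16 * (m : ℝ) ^ 3)) := by
  have hmem : ∀ j < m, m ^ 2 + j * m ∈ I := fun j hj =>
    hI _ (Finset.mem_image_of_mem _ (Finset.mem_range.2 hj))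
  obtain ⟨y, hy⟩ := cfSet_nonempty (hmem 0 (by omega)) (by nlinarith)
  obtain ⟨hy0, hy1⟩ := hy.1
  have hm' : (2 : ℝ) ≤ m := by exact_mod_cast hm
  refine le_coveringNumber (cfSet_subset_Ioo I) (by positivity)
    (fun j => 1 / (((m ^ 2 + j * m : ℕ) : ℝ) + y))
    (fun j hj => one_div_add_mem_cfSet (hmem j hj) (by nlinarith) hy) ?_
  intro i j hij hj
  have hij' : (i : ℝ) + 1 ≤ j := by exact_mod_cast hij
  have hj' : (j : ℝ) + 1 ≤ m := by exact_mod_cast hj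
  have hi0 : (0 : ℝ) ≤ i := Nat.cast_nonneg _
  push_cast
  have hp : 0 < (m : ℝ) ^ 2 + i * m + y := by positivity
  have hq : 0 < (m : ℝ) ^ 2 + j * m + y := by positivity
  have hp2 : (m : ℝ) ^ 2 + i * m + y ≤ 2 * m ^ 2 := by nlinarith
  have hq2 : (m : ℝ) ^ 2 + j * m + y ≤ 2 * m ^ 2 := by nlinarith
  rw [div_sub_div _ _ hp.ne' hq.ne', mul_one_div, div_le_div_iff₀ (by positivity) (by positivity)]
  have h1 : ((m : ℝ) ^ 2 + i * m + y) * (m ^ 2 + j * m + y) ≤ (2 * m ^ 2) * (2 * m ^ 2) := by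
    gcongr
  have h2 : (m : ℝ) ≤ 1 * (m ^ 2 + j * m + y) - (m ^ 2 + i * m + y) * 1 := by nlinarith
  have h3 : (m : ℝ) * (16 * m ^ 3) ≤
      (1 * (m ^ 2 + j * m + y) - (m ^ 2 + i * m + y) * 1) * (16 * m ^ 3) := by gcongr
  nlinarith [pow_pos (by linarith : (0 : ℝ) < m) 4]

/-- The rapidly growing sequence of block lengths. -/
def blockLength (q k : ℕ) : ℕ := (q ^ 200 ^ k) ^ 5

theorem blockLength_succ (q k : ℕ) : blockLength q (k + 1) = blockLength q k ^ 200 := by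
  simp only [blockLength, ← pow_mul]
  congr 1
  ring

theorem le_base_pow (q k : ℕ) : q ≤ q ^ 200 ^ k :=
  Nat.le_self_pow (by positivity) q

theorem base_le_blockLength (q k : ℕ) : q ≤ blockLength q k :=
  (le_base_pow q k).trans (Nat.le_self_pow (by norm_num) _)

theorem blockLength_strictMono {q : ℕ} (hq : 3 ≤ q) : StrictMono (blockLength q) := by
  refine strictMono_nat_of_lt_succ fun k => ?_
  rw [blockLength_succ]
  exact lt_self_pow₀ (by have := base_le_blockLength q k; omega) (by norm_num)

/-- The union of the first `k` blocks. -/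
def blockUnion (q k : ℕ) : Finset ℕ :=
  (Finset.range k).biUnion fun i => progressionBlock (blockLength q i)

theorem sum_progressionBlock_le {q : ℕ} (hq : 3 ≤ q) (k : ℕ) :
    ∑ b ∈ progressionBlock (blockLength q k), ((b : ℝ) ^ 2) ^ (-(3 / 10) : ℝ) ≤
      (1 / 3) ^ (k + 1) := by
  set Q : ℕ := q ^ 200 ^ k with hQ
  have hQk : 3 ^ (k + 1) ≤ Q := by
    have h1 : k + 1 ≤ 200 ^ k := Nat.lt_pow_self (by norm_num)
    exact (Nat.pow_le_pow_left hq _).trans (Nat.pow_le_pow_right (by omega) h1)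
  have hQ0 : (0 : ℝ) < Q := by
    have : 0 < Q := lt_of_lt_of_le (by positivity) hQk
    exact_mod_cast this
  have hterm : ∀ b ∈ progressionBlock (blockLength q k),
      ((b : ℝ) ^ 2) ^ (-(3 / 10) : ℝ) ≤ 1 / (Q : ℝ) ^ 6 := by
    intro b hb
    have hb1 : (Q ^ 5) ^ 2 ≤ b := sq_le_of_mem_progressionBlock hb
    have hb2 : (((Q : ℝ) ^ 5) ^ 2) ≤ b := by exact_mod_cast hb1
    have h1 : (((Q : ℝ) ^ 20)) ≤ (b : ℝ) ^ 2 := by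
      calc (Q : ℝ) ^ 20 = (((Q : ℝ) ^ 5) ^ 2) ^ 2 := by ring
        _ ≤ _ := by gcongr
    have h2 := Real.rpow_le_rpow_of_nonpos (by positivity) h1 (by norm_num : (-(3 / 10) : ℝ) ≤ 0)
    refine h2.trans (le_of_eq ?_)
    rw [← Real.rpow_natCast, ← Real.rpow_mul hQ0.le, one_div, ← Real.rpow_natCast,
      ← Real.rpow_neg hQ0.le]
    norm_num
  have hcard : ((progressionBlock (blockLength q k)).card : ℝ) ≤ (Q : ℝ) ^ 5 := by
    have := card_progressionBlock_le (blockLength q k)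
    exact_mod_cast this
  calc _ ≤ (progressionBlock (blockLength q k)).card • (1 / (Q : ℝ) ^ 6) :=
        Finset.sum_le_card_nsmul _ _ _ hterm
    _ ≤ (Q : ℝ) ^ 5 * (1 / (Q : ℝ) ^ 6) := by rw [nsmul_eq_mul]; gcongr
    _ = 1 / Q := by field_simp
    _ ≤ 1 / 3 ^ (k + 1) := one_div_le_one_div_of_le (by positivity) (by exact_mod_cast hQk)
    _ = _ := by rw [one_div_pow]

theorem sum_blockUnion_le {q : ℕ} (hq : 3 ≤ q) (k : ℕ) :
    ∑ b ∈ blockUnion q k, ((b : ℝ) ^ 2) ^ (-(3 / 10) : ℝ) ≤ 1 / 2 := by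
  have h : ∀ k, ∑ b ∈ blockUnion q k, ((b : ℝ) ^ 2) ^ (-(3 / 10) : ℝ) ≤
      1 / 2 - (1 / 2) * (1 / 3) ^ k := by
    intro k
    induction k with
    | zero => simp [blockUnion]
    | succ k ih =>
      have h1 : blockUnion q (k + 1) =
          progressionBlock (blockLength q k) ∪ blockUnion q k := by
        simp only [blockUnion, Finset.range_add_one, Finset.biUnion_insert]
      have h2 := Finset.sum_union_inter (s₁ := progressionBlock (blockLength q k))
        (s₂ := blockUnion q k) (f := fun b : ℕ => ((b : ℝ) ^ 2) ^ (-(3 / 10) : ℝ))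
      have h3 : 0 ≤ ∑ b ∈ progressionBlock (blockLength q k) ∩ blockUnion q k,
          ((b : ℝ) ^ 2) ^ (-(3 / 10) : ℝ) := Finset.sum_nonneg fun b _ => by positivity
      have h4 := sum_progressionBlock_le hq k
      rw [h1]
      rw [pow_succ] at h4 ⊢
      linarith
  have : (0 : ℝ) ≤ (1 / 2) * (1 / 3) ^ k := by positivity
  linarith [h k]

theorem card_blockUnion_le {q : ℕ} (hq : 3 ≤ q) (k : ℕ) :
    (blockUnion q (k + 1)).card ≤ 2 * blockLength q k ^ 2 := by
  rw [← Finset.card_range (2 * blockLength q k ^ 2)]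
  refine Finset.card_le_card fun b hb => ?_
  obtain ⟨i, hi, hb⟩ := Finset.mem_biUnion.1 hb
  obtain ⟨j, hj, rfl⟩ := Finset.mem_image.1 hb
  rw [Finset.mem_range] at hi hj ⊢
  have h1 : blockLength q i ≤ blockLength q k :=
    (blockLength_strictMono hq).monotone (by omega)
  have h2 : 0 < blockLength q i := by have := base_le_blockLength q i; omega
  nlinarith

theorem dimLB_lt_dimUB_blocks {q : ℕ} (hq : 3 ≤ q) :
    dimLB (cfSet {b | ∃ k, b ∈ progressionBlock (blockLength q k)}) <
      dimUB (cfSet {b | ∃ k, b ∈ progressionBlock (blockLength q k)}) := by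
  set I : Set ℕ := {b | ∃ k, b ∈ progressionBlock (blockLength q k)} with hI
  have hM : ∀ k, 3 ≤ blockLength q k := fun k => hq.trans (base_le_blockLength q k)
  have hM0 : ∀ k, (3 : ℝ) ≤ blockLength q k := fun k => by exact_mod_cast hM k
  have hlim : Tendsto (fun k => (blockLength q (k + 1) : ℝ)) atTop atTop :=
    (tendsto_natCast_atTop_atTop.comp (blockLength_strictMono hq).tendsto_atTop).comp
      (tendsto_add_atTop_nat 1)
  have hlow : dimLB (cfSet I) ≤ 31 / 100 := by
    refine dimLB_le_of_seq
      (fun k => 1 / (blockLength q (k + 1) : ℝ) ^ 2) ?_ fun k => ?_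
    · refine tendsto_nhdsWithin_iff.2 ⟨?_, Eventually.of_forall fun k => ?_⟩
      · simp only [one_div]
        exact tendsto_inv_atTop_zero.comp ((tendsto_pow_atTop two_ne_zero).comp hlim)
      · have := hM0 (k + 1)
        exact mem_Ioi.2 (by positivity)
    set m : ℝ := ((blockLength q k : ℕ) : ℝ) with hm
    have hm3 : 3 ≤ m := hM0 k
    have hsucc : (blockLength q (k + 1) : ℝ) = m ^ 200 := by
      rw [blockLength_succ]; push_cast; rfl
    rw [hsucc]
    have hbound := coveringNumber_cfSet_le_rpow (I := I) (A := blockUnion q (k + 1))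
      (L := (m ^ 200) ^ 2) (t := 3 / 10) (r := 1 / (m ^ 200) ^ 2) ?_ (by positivity) (by norm_num)
      ?_ (sum_blockUnion_le hq (k + 1)) le_rfl
    rotate_left
    · intro b hb
      obtain ⟨i, -, hb⟩ := Finset.mem_biUnion.1 hb
      have := sq_le_of_mem_progressionBlock hb
      have := hM i
      nlinarith
    · rintro b ⟨i, hi⟩ hb
      have hik : k + 1 ≤ i := by
        by_contra! h
        exact hb (Finset.mem_biUnion.2 ⟨i, Finset.mem_range.2 h, hi⟩)
      have h1 := (blockLength_strictMono hq).monotone hik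
      have h2 := sq_le_of_mem_progressionBlock hi
      have h3 : blockLength q (k + 1) ^ 2 ≤ b := (Nat.pow_le_pow_left h1 2).trans h2
      rw [← hsucc]
      exact_mod_cast h3
    have hpow : (1 / (m ^ 200) ^ 2) ^ (-(3 / 10) : ℝ) = m ^ 120 := by
      rw [one_div, ← pow_mul, Real.inv_rpow (by positivity), Real.rpow_neg (by positivity), inv_inv,
        ← Real.rpow_natCast, ← Real.rpow_mul (by positivity), ← Real.rpow_natCast]
      norm_num
    rw [hpow] at hbound
    have hcard : ((blockUnion q (k + 1)).card : ℝ) ≤ 2 * m ^ 2 := by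
      rw [hm]
      exact_mod_cast card_blockUnion_le hq k
    have hfinal : (coveringNumber (cfSet I) (1 / (m ^ 200) ^ 2) : ℝ) ≤ m ^ 124 := by
      have h1 : 1 ≤ m ^ 120 := one_le_pow₀ (by linarith)
      have h2 : 2 * (1 + 2 * m ^ 2) + 1 ≤ m ^ 4 := by
        have : 9 ≤ m ^ 2 := by nlinarith
        nlinarith
      calc _ ≤ 2 * (1 + ((blockUnion q (k + 1)).card : ℝ)) * m ^ 120 + 1 := hbound
        _ ≤ 2 * (1 + 2 * m ^ 2) * m ^ 120 + m ^ 120 := by gcongr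
        _ = (2 * (1 + 2 * m ^ 2) + 1) * m ^ 120 := by ring
        _ ≤ m ^ 4 * m ^ 120 := by gcongr
        _ = m ^ 124 := by ring
    have hlogm : 0 < Real.log m := Real.log_pos (by linarith)
    unfold sFun
    rw [one_div_one_div, ← pow_mul, Real.log_pow, div_le_iff₀ (by positivity), pow_mul]
    rcases Nat.eq_zero_or_pos (coveringNumber (cfSet I) (1 / (m ^ 200) ^ 2)) with h | h
    · rw [h]; simp only [Nat.cast_zero, Real.log_zero]; positivity
    · have := Real.log_le_log (by exact_mod_cast h) hfinal
      rw [Real.log_pow] at this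
      push_cast at this ⊢
      linarith
  have hup : 32 / 100 ≤ dimUB (cfSet I) := by
    refine le_dimUB_of_seq (cfSet_subset_Ioo I)
      (fun k => 1 / (16 * (blockLength q (k + 1) : ℝ) ^ 3)) ?_ fun k => ?_
    · refine tendsto_nhdsWithin_iff.2 ⟨?_, Eventually.of_forall fun k => ?_⟩
      · simp only [one_div]
        exact tendsto_inv_atTop_zero.comp
          (((tendsto_pow_atTop three_ne_zero).comp hlim).const_mul_atTop (by norm_num))
      · have := hM0 (k + 1)
        exact mem_Ioi.2 (by positivity)
    have hcov := le_coveringNumber_cfSet (I := I) (m := blockLength q (k + 1))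
      (by have := hM (k + 1); omega) fun b hb => ⟨k + 1, hb⟩
    set m : ℝ := ((blockLength q (k + 1) : ℕ) : ℝ) with hm
    have hm3 : 3 ≤ m := hM0 (k + 1)
    have hbig : 16 ^ 8 ≤ m := by
      have h1 : (m : ℝ) = (blockLength q k : ℝ) ^ 200 := by
        rw [hm, blockLength_succ]; push_cast; rfl
      rw [h1]
      calc (16 : ℝ) ^ 8 ≤ 3 ^ 200 := by norm_num
        _ ≤ _ := by gcongr; exact hM0 k
    have hcov' : m ≤ (coveringNumber (cfSet I) (1 / (16 * m ^ 3)) : ℝ) := Nat.cast_le.2 hcov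
    have h1 := Real.log_le_log (by positivity) hbig
    have h2 := Real.log_le_log (by positivity) hcov'
    have h16 : 0 < Real.log 16 := Real.log_pos (by norm_num)
    rw [Real.log_pow] at h1
    have hlogm : 0 < Real.log m := Real.log_pos (by linarith)
    unfold sFun
    rw [one_div_one_div, Real.log_mul (by norm_num) (by positivity), Real.log_pow,
      le_div_iff₀ (by positivity)]
    push_cast at h1 ⊢
    linarith
  linarith

/-- For every `0 < a < 1` there is an infinite proper subset `I ⊆ ℕ` with
`Λ_I ⊆ (0, a)` whose box dimension does not exist. -/
theorem cfSet_box_dim_not_exists :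
    ∀ a : ℝ, 0 < a → a < 1 →
      ∃ I : Set ℕ, I.Infinite ∧ I ≠ Set.univ ∧
        cfSet I ⊆ Set.Ioo 0 a ∧ dimLB (cfSet I) < dimUB (cfSet I) := by
  intro a ha0 ha1
  obtain ⟨n, hn⟩ := exists_nat_gt (1 / a)
  have hq : 3 ≤ n + 3 := by omega
  have hlarge : ∀ b k, b ∈ progressionBlock (blockLength (n + 3) k) → n + 3 ≤ b := fun b k hb =>
    (base_le_blockLength _ k).trans
      ((Nat.le_self_pow two_ne_zero _).trans (sq_le_of_mem_progressionBlock hb))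
  refine ⟨{b | ∃ k, b ∈ progressionBlock (blockLength (n + 3) k)}, ?_, ?_, ?_,
    dimLB_lt_dimUB_blocks hq⟩
  · refine infinite_of_injective_forall_mem
      (f := fun k => blockLength (n + 3) k ^ 2) ?_ fun k => ⟨k, ?_⟩
    · exact (Nat.pow_left_injective two_ne_zero).comp (blockLength_strictMono hq).injective
    · have := base_le_blockLength (n + 3) k
      exact Finset.mem_image.2 ⟨0, Finset.mem_range.2 (by omega), by ring⟩
  · intro h
    obtain ⟨k, hk⟩ := h.symm ▸ mem_univ 0
    have := hlarge 0 k hk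
    omega
  · intro x hx
    obtain ⟨b, ⟨k, hb⟩, y, hy, rfl⟩ := exists_of_mem_cfSet hx
    refine ⟨hx.1.1, ?_⟩
    have hb' : ((n + 3 : ℕ) : ℝ) ≤ b := by exact_mod_cast hlarge b k hb
    push_cast at hb'
    have hy0 := hy.1.1
    have ha' : 0 < 1 / a := by positivity
    rw [one_div_lt (by linarith) ha0]
    linarith

end
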